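/- Let j be a negative half-integer. The space of linear maps φ : D⁺_j ⊗ D⁻_j → ℂ satisfying φ ∘ (x ⊗ id + id ⊗ x) = 0 for all x ∈ sl(2,ℂ) (i.e. the space of sl(2,ℂ)-module homomorphisms from D⁺_j ⊗ D⁻_j to the trivial module D₀) is one-dimensional, spanned by the map ψ_j determined by ψ_j(|j,m⟩₊ ⊗ |j,n⟩₋) = δ_{m,n}. -/

import Mathlib

/-!
Discrete-series weight modules `D⁺_j` and `D⁻_j` of `sl(2,ℂ)`.

`sl(2,ℂ)` is taken to be Mathlib's Lie algebra of traceless `2×2` complex matrices,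
with basis `J⁰ = diag(1,-1)`, `J⁺ = E₀₁`, `J⁻ = E₁₀`, so that
`[J⁺,J⁻] = J⁰`, `[J⁰,J^±] = ±2 J^±`.  A general element
`x` decomposes as `x = x₀₀·J⁰ + x₀₁·J⁺ + x₁₀·J⁻`, and an action of `sl(2,ℂ)` is
specified by the three operators representing `J⁰`, `J⁺`, `J⁻`.

The underlying space of `D^±_j` is the space `ℕ →₀ ℂ` of finitely supported
functions, with standard basis `ket m = |j,m⟩`.
-/

noncomputable section

abbrev Dspace : Type := ℕ →₀ ℂ

/-- the basis vector `|j,m⟩` -/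
def ket (m : ℕ) : Dspace := Finsupp.single m 1

/-- diagonal operator `ket m ↦ c m • ket m` -/
def diagOp (c : ℕ → ℂ) : Dspace →ₗ[ℂ] Dspace :=
  Finsupp.lsum ℂ fun m => c m • Finsupp.lsingle m

/-- raising operator `ket m ↦ c m • ket (m+1)` -/
def raiseOp (c : ℕ → ℂ) : Dspace →ₗ[ℂ] Dspace :=
  Finsupp.lsum ℂ fun m => c m • Finsupp.lsingle (m + 1)

/-- lowering operator `ket m ↦ c m • ket (m-1)` (with `c 0 = 0` in all uses below) -/
def lowerOp (c : ℕ → ℂ) : Dspace →ₗ[ℂ] Dspace :=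
  Finsupp.lsum ℂ fun m => c m • Finsupp.lsingle (m - 1)

/-- `√((m+1)(m−2j))` -/
def aCoeff (j : ℝ) (m : ℕ) : ℂ := (Real.sqrt ((m + 1) * (m - 2 * j)) : ℝ)

/-- `√(m(m−1−2j))` -/
def bCoeff (j : ℝ) (m : ℕ) : ℂ := (Real.sqrt (m * (m - 1 - 2 * j)) : ℝ)

/-- `J⁰` on `D⁺_j`:  `J⁰|j,m⟩ = 2(−j+m)|j,m⟩` -/
def JzP (j : ℝ) : Dspace →ₗ[ℂ] Dspace := diagOp fun m => 2 * (-(j : ℂ) + m)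

/-- `J⁺` on `D⁺_j`:  `J⁺|j,m⟩ = √((m+1)(m−2j)) |j,m+1⟩` -/
def JpP (j : ℝ) : Dspace →ₗ[ℂ] Dspace := raiseOp fun m => aCoeff j m

/-- `J⁻` on `D⁺_j`:  `J⁻|j,m⟩ = −√(m(m−1−2j)) |j,m−1⟩` -/
def JmP (j : ℝ) : Dspace →ₗ[ℂ] Dspace := lowerOp fun m => -bCoeff j m

/-- `J⁰` on `D⁻_j`:  `J⁰|j,m⟩ = 2(j−m)|j,m⟩` -/
def JzM (j : ℝ) : Dspace →ₗ[ℂ] Dspace := diagOp fun m => 2 * ((j : ℂ) - m)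

/-- `J⁺` on `D⁻_j`:  `J⁺|j,m⟩ = −√(m(m−1−2j)) |j,m−1⟩` -/
def JpM (j : ℝ) : Dspace →ₗ[ℂ] Dspace := lowerOp fun m => -bCoeff j m

/-- `J⁻` on `D⁻_j`:  `J⁻|j,m⟩ = √((m+1)(m−2j)) |j,m+1⟩` -/
def JmM (j : ℝ) : Dspace →ₗ[ℂ] Dspace := raiseOp fun m => aCoeff j m

/-- the Lie algebra `sl(2,ℂ)` -/
abbrev sl2 := LieAlgebra.SpecialLinear.sl (Fin 2) ℂ

/-- the action of a general element `x = x₀₀·J⁰ + x₀₁·J⁺ + x₁₀·J⁻` of `sl(2,ℂ)`,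
given the operators representing the basis `J⁰, J⁺, J⁻`. -/
def actOf (Jz Jp Jm : Dspace →ₗ[ℂ] Dspace) (x : sl2) : Dspace →ₗ[ℂ] Dspace :=
  (x : Matrix (Fin 2) (Fin 2) ℂ) 0 0 • Jz + (x : Matrix (Fin 2) (Fin 2) ℂ) 0 1 • Jp +
    (x : Matrix (Fin 2) (Fin 2) ℂ) 1 0 • Jm

/-- the action of `x ∈ sl(2,ℂ)` on `D⁺_j` -/
def actP (j : ℝ) (x : sl2) : Dspace →ₗ[ℂ] Dspace := actOf (JzP j) (JpP j) (JmP j) x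

/-- the action of `x ∈ sl(2,ℂ)` on `D⁻_j` -/
def actM (j : ℝ) (x : sl2) : Dspace →ₗ[ℂ] Dspace := actOf (JzM j) (JpM j) (JmM j) x

/-- the bilinear pairing `β_j` of `D⁺_j` with `D⁻_j`, `β_j(|j,m⟩₊,|j,n⟩₋) = δ_{m,n}` -/
def betaForm : Dspace →ₗ[ℂ] Dspace →ₗ[ℂ] ℂ :=
  Finsupp.lsum ℂ fun m => LinearMap.toSpanSingleton ℂ (Dspace →ₗ[ℂ] ℂ) (Finsupp.lapply m)

open TensorProduct

/-- the linear map `ψ_j : D⁺_j ⊗ D⁻_j → ℂ` with `ψ_j(|j,m⟩₊ ⊗ |j,n⟩₋) = δ_{m,n}` -/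
def psiForm : (Dspace ⊗[ℂ] Dspace) →ₗ[ℂ] ℂ := TensorProduct.lift betaForm

theorem diagOp_ket (c : ℕ → ℂ) (m : ℕ) : diagOp c (ket m) = c m • ket m := by
  simp [diagOp, ket]

theorem raiseOp_ket (c : ℕ → ℂ) (m : ℕ) : raiseOp c (ket m) = c m • ket (m + 1) := by
  simp [raiseOp, ket]

theorem lowerOp_ket (c : ℕ → ℂ) (m : ℕ) : lowerOp c (ket m) = c m • ket (m - 1) := by
  simp [lowerOp, ket]

theorem psiForm_ket (m n : ℕ) :
    psiForm (ket m ⊗ₜ[ℂ] ket n) = if m = n then 1 else 0 := by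
  simp [psiForm, betaForm, ket, Finsupp.single_apply, eq_comm]

theorem bCoeff_zero (j : ℝ) : bCoeff j 0 = 0 := by simp [bCoeff]

theorem bCoeff_succ (j : ℝ) (m : ℕ) : bCoeff j (m + 1) = aCoeff j m := by
  simp [bCoeff, aCoeff]

theorem aCoeff_ne (j : ℝ) (hj : j < 0) (m : ℕ) : aCoeff j m ≠ 0 := by
  have h : 0 < ((m : ℝ) + 1) * (m - 2 * j) := by
    have : (0 : ℝ) ≤ m := Nat.cast_nonneg m
    apply mul_pos <;> linarith
  simpa [aCoeff] using (Real.sqrt_pos.2 h).ne'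

theorem tensor_ext_ket {f g : (Dspace ⊗[ℂ] Dspace) →ₗ[ℂ] ℂ}
    (h : ∀ m n : ℕ, f (ket m ⊗ₜ[ℂ] ket n) = g (ket m ⊗ₜ[ℂ] ket n)) : f = g := by
  apply TensorProduct.ext
  apply Finsupp.lhom_ext'
  intro m
  apply LinearMap.ext_ring
  apply Finsupp.lhom_ext'
  intro n
  apply LinearMap.ext_ring
  exact h m n

/-- the value of `φ ∘ (x ⊗ id + id ⊗ x)` on a basis vector -/
theorem inv_ket (j : ℝ) (x : sl2) (φ : (Dspace ⊗[ℂ] Dspace) →ₗ[ℂ] ℂ) (m n : ℕ) :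
    (φ ∘ₗ (TensorProduct.map (actP j x) LinearMap.id
        + TensorProduct.map LinearMap.id (actM j x))) (ket m ⊗ₜ[ℂ] ket n) =
      x.1 0 0 * (2 * ((m : ℂ) - n) * φ (ket m ⊗ₜ[ℂ] ket n)) +
      x.1 0 1 * (aCoeff j m * φ (ket (m + 1) ⊗ₜ[ℂ] ket n)
        - bCoeff j n * φ (ket m ⊗ₜ[ℂ] ket (n - 1))) +
      x.1 1 0 * (aCoeff j n * φ (ket m ⊗ₜ[ℂ] ket (n + 1))
        - bCoeff j m * φ (ket (m - 1) ⊗ₜ[ℂ] ket n)) := by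
  simp only [actP, actM, actOf, JzP, JpP, JmP, JzM, JpM, JmM, LinearMap.comp_apply,
    LinearMap.add_apply, TensorProduct.map_tmul, LinearMap.id_apply, LinearMap.smul_apply,
    diagOp_ket, raiseOp_ket, lowerOp_ket, TensorProduct.add_tmul, TensorProduct.tmul_add,
    ← TensorProduct.smul_tmul', TensorProduct.tmul_smul, map_add, map_smul, smul_eq_mul]
  ring

/-- Let `j` be a negative half-integer.  The space of linear maps
`φ : D⁺_j ⊗ D⁻_j → ℂ` satisfying `φ ∘ (x ⊗ id + id ⊗ x) = 0` for all `x ∈ sl(2,ℂ)`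
(i.e. `sl(2,ℂ)`-module homomorphisms to the trivial module `D₀ = ℂ`) is
one-dimensional, spanned by the map `ψ_j` determined by
`ψ_j(|j,m⟩₊ ⊗ |j,n⟩₋) = δ_{m,n}`. -/
theorem statement2 (j : ℝ) (hhalf : ∃ n : ℤ, (n : ℝ) = 2 * j) (hneg : j < 0) :
    (∀ m n : ℕ, psiForm (ket m ⊗ₜ[ℂ] ket n) = if m = n then 1 else 0) ∧
    (∀ x : sl2,
      psiForm ∘ₗ (TensorProduct.map (actP j x) LinearMap.id
        + TensorProduct.map LinearMap.id (actM j x)) = 0) ∧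
    psiForm ≠ 0 ∧
    (∀ φ : (Dspace ⊗[ℂ] Dspace) →ₗ[ℂ] ℂ,
      (∀ x : sl2,
        φ ∘ₗ (TensorProduct.map (actP j x) LinearMap.id
          + TensorProduct.map LinearMap.id (actM j x)) = 0) →
      ∃ c : ℂ, φ = c • psiForm) := by
  refine ⟨psiForm_ket, ?_, ?_, ?_⟩
  · intro x
    apply tensor_ext_ket
    intro m n
    rw [inv_ket, LinearMap.zero_apply]
    simp only [psiForm_ket]
    have h0 : 2 * ((m : ℂ) - n) * (if m = n then 1 else 0) = 0 := by
      split_ifs with h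
      · simp [h]
      · simp
    have key : ∀ p q : ℕ, aCoeff j p * (if p + 1 = q then 1 else 0)
        - bCoeff j q * (if p = q - 1 then 1 else 0) = 0 := by
      intro p q
      cases q with
      | zero => simp [bCoeff_zero]
      | succ q =>
        by_cases h : p = q
        · subst h; simp [bCoeff_succ]
        · simp [h]
    have h1 := key m n
    have h2 := key n m
    simp only [eq_comm (a := n + 1), eq_comm (a := n) (b := m - 1)] at h2
    rw [h0, h1, h2]
    ring
  · intro h
    have := psiForm_ket 0 0
    simp [h] at this
  · intro φ hφ
    have hz : ∀ m n : ℕ, m ≠ n → φ (ket m ⊗ₜ[ℂ] ket n) = 0 := by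
      intro m n hmn
      let x : sl2 := ⟨!![1, 0; 0, -1], by
        refine LinearMap.mem_ker.2 (?_ : Matrix.traceLinearMap (Fin 2) ℂ ℂ _ = 0)
        simp [Matrix.trace_fin_two]⟩
      have h := inv_ket j x φ m n
      rw [hφ x] at h
      have hne : (m : ℂ) - n ≠ 0 := sub_ne_zero.2 (by exact_mod_cast hmn)
      simpa [x, hne] using h
    have hd : ∀ m : ℕ, φ (ket m ⊗ₜ[ℂ] ket m) = φ (ket 0 ⊗ₜ[ℂ] ket 0) := by
      intro m
      induction m with
      | zero => rfl
      | succ m ih =>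
        let x : sl2 := ⟨!![0, 1; 0, 0], by
          refine LinearMap.mem_ker.2 (?_ : Matrix.traceLinearMap (Fin 2) ℂ ℂ _ = 0)
          simp [Matrix.trace_fin_two]⟩
        have h := inv_ket j x φ m (m + 1)
        rw [hφ x] at h
        simp [x, bCoeff_succ] at h
        rw [← ih]
        apply mul_left_cancel₀ (aCoeff_ne j hneg m)
        linear_combination -h
    refine ⟨φ (ket 0 ⊗ₜ[ℂ] ket 0), tensor_ext_ket fun m n => ?_⟩
    rw [LinearMap.smul_apply, psiForm_ket]
    by_cases h : m = n
    · subst h; simp [hd m]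
    · simp [h, hz m n h]
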